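/- Suppose m_k > 0 for each k ∈ [K], ε > 0, and 0 < λ ≤ d(√(m/m_max) − 1)/(m(√(m/m_max) + 1)ε²). If Z ∈ ℝ^{d×m} is a critical point of the regularized MCR² objective F and there exist 1 ≤ k ≠ l ≤ K such that Z_kᵀZ_l ≠ 0, then Z is a strict saddle point of F, i.e., there exists a direction D ∈ ℝ^{d×m} with ∇²F(Z)[D, D] > 0. -/

import Mathlib

open Matrix BigOperators Finset

noncomputable section

/-- The `k`-th block of columns of the feature matrix `Z`. -/
def blk {d K : ℕ} (mk : Fin K → ℕ) (Z : Matrix (Fin d) ((k : Fin K) × Fin (mk k)) ℝ)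
    (k : Fin K) : Matrix (Fin d) (Fin (mk k)) ℝ :=
  Matrix.of fun i j => Z i ⟨k, j⟩

/-- Squared Frobenius norm. -/
def frobSq {n m : Type*} [Fintype n] [Fintype m] (A : Matrix n m ℝ) : ℝ :=
  ∑ i, ∑ j, A i j ^ 2

/-- The (lossy) coding rate `(1/2) log det (I + a • A * Aᵀ)`. -/
def codingRate {d : ℕ} {n : Type*} [Fintype n] (a : ℝ) (A : Matrix (Fin d) n ℝ) : ℝ :=
  (1 / 2) * Real.log ((1 + a • (A * Aᵀ)).det)

/-- Total number of samples `m = ∑ k, m_k`. -/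
def mTot {K : ℕ} (mk : Fin K → ℕ) : ℕ := ∑ k, mk k

/-- `α = d / (m ε²)`. -/
def alph (d : ℕ) {K : ℕ} (mk : Fin K → ℕ) (ε : ℝ) : ℝ :=
  (d : ℝ) / ((mTot mk : ℝ) * ε ^ 2)

/-- `α_k = d / (m_k ε²)`. -/
def alphK (d : ℕ) {K : ℕ} (mk : Fin K → ℕ) (ε : ℝ) (k : Fin K) : ℝ :=
  (d : ℝ) / ((mk k : ℝ) * ε ^ 2)

/-- The regularized MCR² objective
`F(Z) = R(Z) − ∑ k (m_k/m) R_c(Z_k) − (λ/2) ‖Z‖_F²`. -/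
def mcr2F (d K : ℕ) (mk : Fin K → ℕ) (ε lam : ℝ)
    (Z : Matrix (Fin d) ((k : Fin K) × Fin (mk k)) ℝ) : ℝ :=
  codingRate (alph d mk ε) Z
    - ∑ k, ((mk k : ℝ) / (mTot mk : ℝ)) * codingRate (alphK d mk ε k) (blk mk Z k)
    - (lam / 2) * frobSq Z

/-- The first-order (criticality) condition `∇F(Z) = 0`, i.e.
`α (I + α Z Zᵀ)⁻¹ Z_k − α (I + α_k Z_k Z_kᵀ)⁻¹ Z_k − λ Z_k = 0` for all `k`. -/
def IsCriticalPt (d K : ℕ) (mk : Fin K → ℕ) (ε lam : ℝ)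
    (Z : Matrix (Fin d) ((k : Fin K) × Fin (mk k)) ℝ) : Prop :=
  ∀ k : Fin K,
    alph d mk ε • ((1 + alph d mk ε • (Z * Zᵀ))⁻¹ * blk mk Z k)
      - alph d mk ε • ((1 + alphK d mk ε k • (blk mk Z k * (blk mk Z k)ᵀ))⁻¹ * blk mk Z k)
      - lam • blk mk Z k = 0

/-- Second derivative of `f` at `Z` along direction `D`, `∇²f(Z)[D,D]`. -/
def hessAlong {d K : ℕ} {mk : Fin K → ℕ}
    (f : Matrix (Fin d) ((k : Fin K) × Fin (mk k)) ℝ → ℝ)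
    (Z D : Matrix (Fin d) ((k : Fin K) × Fin (mk k)) ℝ) : ℝ :=
  iteratedDeriv 2 (fun t : ℝ => f (Z + t • D)) 0

/-- Upper bound for the regularization parameter:
`d (√(m/m_max) − 1) / (m (√(m/m_max) + 1) ε²)`. -/
def lamBound (d : ℕ) {K : ℕ} (mk : Fin K → ℕ) (ε : ℝ) : ℝ :=
  (d : ℝ) * (Real.sqrt ((mTot mk : ℝ) / ((Finset.univ.sup mk : ℕ) : ℝ)) - 1) /
    ((mTot mk : ℝ) * (Real.sqrt ((mTot mk : ℝ) / ((Finset.univ.sup mk : ℕ) : ℝ)) + 1) * ε ^ 2)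

/-- `η_k = (α_k − α) − λ (m/m_k + 1)`. -/
def etaK (d : ℕ) {K : ℕ} (mk : Fin K → ℕ) (ε lam : ℝ) (k : Fin K) : ℝ :=
  (alphK d mk ε k - alph d mk ε) - lam * ((mTot mk : ℝ) / (mk k : ℝ) + 1)

/-- `σ̄_k = ((η_k + √(η_k² − 4λ²m/m_k)) / (2λα_k))^(1/2)`. -/
def sigBar (d : ℕ) {K : ℕ} (mk : Fin K → ℕ) (ε lam : ℝ) (k : Fin K) : ℝ :=
  Real.sqrt ((etaK d mk ε lam k
      + Real.sqrt (etaK d mk ε lam k ^ 2 - 4 * lam ^ 2 * ((mTot mk : ℝ) / (mk k : ℝ))))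
    / (2 * lam * alphK d mk ε k))

/-- `σ̲_k = ((η_k − √(η_k² − 4λ²m/m_k)) / (2λα_k))^(1/2)`. -/
def sigUnd (d : ℕ) {K : ℕ} (mk : Fin K → ℕ) (ε lam : ℝ) (k : Fin K) : ℝ :=
  Real.sqrt ((etaK d mk ε lam k
      - Real.sqrt (etaK d mk ε lam k ^ 2 - 4 * lam ^ 2 * ((mTot mk : ℝ) / (mk k : ℝ))))
    / (2 * lam * alphK d mk ε k))


/-- `f` is differentiable near `x` and its derivative has derivative `c` at `x`. -/
def HasSecondDerivAt (f : ℝ → ℝ) (c x : ℝ) : Prop :=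
  ∃ f' : ℝ → ℝ, (∀ᶠ t in nhds x, HasDerivAt f (f' t) t) ∧ HasDerivAt f' c x

namespace HasSecondDerivAt

variable {f g : ℝ → ℝ} {a b x : ℝ}

lemma iteratedDeriv_eq (hf : HasSecondDerivAt f a x) : iteratedDeriv 2 f x = a := by
  obtain ⟨f', h, h'⟩ := hf
  rw [iteratedDeriv_succ, iteratedDeriv_one]
  have : deriv f =ᶠ[nhds x] f' := h.mono fun t ht => ht.deriv
  rw [this.deriv_eq, h'.deriv]

lemma sub (hf : HasSecondDerivAt f a x) (hg : HasSecondDerivAt g b x) :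
    HasSecondDerivAt (fun t => f t - g t) (a - b) x := by
  obtain ⟨f', hf₁, hf₂⟩ := hf
  obtain ⟨g', hg₁, hg₂⟩ := hg
  exact ⟨fun t => f' t - g' t, by filter_upwards [hf₁, hg₁] with t h₁ h₂ using h₁.sub h₂,
    hf₂.sub hg₂⟩

lemma const_mul (r : ℝ) (hf : HasSecondDerivAt f a x) :
    HasSecondDerivAt (fun t => r * f t) (r * a) x := by
  obtain ⟨f', hf₁, hf₂⟩ := hf
  exact ⟨fun t => r * f' t, hf₁.mono fun t h => h.const_mul r, hf₂.const_mul r⟩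

lemma sum {ι : Type*} [Fintype ι] {F : ι → ℝ → ℝ} {A : ι → ℝ}
    (h : ∀ i, HasSecondDerivAt (F i) (A i) x) :
    HasSecondDerivAt (fun t => ∑ i, F i t) (∑ i, A i) x := by
  choose F' h₁ h₂ using h
  refine ⟨fun t => ∑ i, F' i t, ?_, HasDerivAt.fun_sum fun i _ => h₂ i⟩
  filter_upwards [Filter.eventually_all.2 h₁] with t ht
  exact HasDerivAt.fun_sum fun i _ => ht i

lemma quadratic (p q r : ℝ) :
    HasSecondDerivAt (fun t => p + q * t + r * t ^ 2) (2 * r) 0 := by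
  refine ⟨fun t => q + 2 * r * t, .of_forall fun t => ?_, ?_⟩
  · have h := (((hasDerivAt_id t).const_mul q).const_add p).add
      (((hasDerivAt_id t).pow 2).const_mul r)
    refine h.congr_deriv ?_
    simp
    ring
  · simpa using ((hasDerivAt_id (0 : ℝ)).const_mul (2 * r)).const_add q

lemma log_quadratic {δ : ℝ} (hδ : δ ≠ 0) (p q : ℝ) :
    HasSecondDerivAt (fun t => Real.log (δ * (1 + p * t + q * t ^ 2))) (2 * q - p ^ 2) 0 := by
  have hd : ∀ t, HasDerivAt (fun t : ℝ => 1 + p * t + q * t ^ 2) (p + 2 * q * t) t := by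
    intro t
    have h := (((hasDerivAt_id t).const_mul p).const_add 1).add
      (((hasDerivAt_id t).pow 2).const_mul q)
    refine h.congr_deriv ?_
    simp
    ring
  have hd' : HasDerivAt (fun t : ℝ => p + 2 * q * t) (2 * q) 0 := by
    simpa using ((hasDerivAt_id (0 : ℝ)).const_mul (2 * q)).const_add p
  refine ⟨fun t => (p + 2 * q * t) / (1 + p * t + q * t ^ 2), ?_, ?_⟩
  · have hne : ∀ᶠ t in nhds (0 : ℝ), 1 + p * t + q * t ^ 2 ≠ 0 :=
      (hd 0).continuousAt.eventually_ne (by simp)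
    filter_upwards [hne] with t ht
    refine (((hd t).const_mul δ).log (mul_ne_zero hδ ht)).congr_deriv ?_
    rw [mul_div_mul_left _ _ hδ]
  · refine (hd'.div (hd 0) (by simp)).congr_deriv ?_
    simp
    ring

end HasSecondDerivAt

section CodingMatrix

variable {n : Type*} [Fintype n] {d : ℕ}

lemma posDef_one_add_smul_mul_transpose {a : ℝ} (ha : 0 ≤ a) (A : Matrix (Fin d) n ℝ) :
    (1 + a • (A * Aᵀ)).PosDef := by
  refine Matrix.PosDef.one.add_posSemidef (Matrix.PosSemidef.smul ?_ ha)
  simpa using Matrix.posSemidef_self_mul_conjTranspose A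

lemma isUnit_det_one_add_smul_mul_transpose {a : ℝ} (ha : 0 ≤ a) (A : Matrix (Fin d) n ℝ) :
    IsUnit (1 + a • (A * Aᵀ)).det :=
  (posDef_one_add_smul_mul_transpose ha A).det_pos.ne'.isUnit

lemma inv_one_add_smul_mul_transpose_isSymm (a : ℝ) (A : Matrix (Fin d) n ℝ) :
    ((1 + a • (A * Aᵀ))⁻¹)ᵀ = (1 + a • (A * Aᵀ))⁻¹ := by
  rw [Matrix.transpose_nonsing_inv]
  simp

lemma dotProduct_inv_one_add_smul_mul_transpose_comm (a : ℝ) (A : Matrix (Fin d) n ℝ)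
    (x y : Fin d → ℝ) :
    x ⬝ᵥ (1 + a • (A * Aᵀ))⁻¹ *ᵥ y = y ⬝ᵥ (1 + a • (A * Aᵀ))⁻¹ *ᵥ x := by
  rw [dotProduct_comm, dotProduct_mulVec y, ← mulVec_transpose,
    inv_one_add_smul_mul_transpose_isSymm]

/-- The resolvent of a Gram matrix is a contraction for the quadratic form. -/
lemma dotProduct_inv_one_add_smul_mul_transpose_le {a : ℝ} (ha : 0 ≤ a)
    (A : Matrix (Fin d) n ℝ) (x : Fin d → ℝ) :
    x ⬝ᵥ (1 + a • (A * Aᵀ))⁻¹ *ᵥ x ≤ x ⬝ᵥ x := by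
  obtain ⟨y, hy⟩ : ∃ y, y = (1 + a • (A * Aᵀ))⁻¹ *ᵥ x := ⟨_, rfl⟩
  have hx : x = y + a • (A *ᵥ (Aᵀ *ᵥ y)) := by
    have : (1 + a • (A * Aᵀ)) *ᵥ y = x := by
      rw [hy, mulVec_mulVec, Matrix.mul_nonsing_inv _
        (isUnit_det_one_add_smul_mul_transpose ha A), one_mulVec]
    rw [← this, add_mulVec, one_mulVec, smul_mulVec, mulVec_mulVec]
  have h₁ : y ⬝ᵥ A *ᵥ (Aᵀ *ᵥ y) = (Aᵀ *ᵥ y) ⬝ᵥ (Aᵀ *ᵥ y) := by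
    rw [dotProduct_mulVec, ← mulVec_transpose]
  have h₂ := dotProduct_star_self_nonneg (Aᵀ *ᵥ y)
  have h₃ := dotProduct_star_self_nonneg (A *ᵥ (Aᵀ *ᵥ y))
  rw [star_trivial] at h₂ h₃
  have hxx : x ⬝ᵥ x - x ⬝ᵥ y = a * ((Aᵀ *ᵥ y) ⬝ᵥ (Aᵀ *ᵥ y))
      + a ^ 2 * (A *ᵥ (Aᵀ *ᵥ y) ⬝ᵥ A *ᵥ (Aᵀ *ᵥ y)) := by
    rw [hx]
    simp only [add_dotProduct, dotProduct_add, smul_dotProduct, dotProduct_smul, smul_eq_mul, h₁,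
      dotProduct_comm (A *ᵥ (Aᵀ *ᵥ y)) y]
    ring
  rw [← hy]
  nlinarith [mul_nonneg ha h₂, mul_nonneg (sq_nonneg a) h₃]

/-- The determinant of `1 + a A Aᵀ` along a rank-one line is a quadratic polynomial. -/
lemma det_one_add_smul_rankOne_line {a : ℝ} (ha : 0 ≤ a) (A : Matrix (Fin d) n ℝ)
    (x : Fin d → ℝ) (w : n → ℝ) (t : ℝ) :
    (1 + a • ((A + t • vecMulVec x w) * (A + t • vecMulVec x w)ᵀ)).det =
      (1 + a • (A * Aᵀ)).det *
        (1 + 2 * a * (x ⬝ᵥ (1 + a • (A * Aᵀ))⁻¹ *ᵥ (A *ᵥ w)) * t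
          + a * ((w ⬝ᵥ w) * (x ⬝ᵥ (1 + a • (A * Aᵀ))⁻¹ *ᵥ x)
            + a * (x ⬝ᵥ (1 + a • (A * Aᵀ))⁻¹ *ᵥ (A *ᵥ w)) ^ 2
            - a * (x ⬝ᵥ (1 + a • (A * Aᵀ))⁻¹ *ᵥ x)
              * ((A *ᵥ w) ⬝ᵥ (1 + a • (A * Aᵀ))⁻¹ *ᵥ (A *ᵥ w))) * t ^ 2) := by
  set z := A *ᵥ w with hz
  have hzx := dotProduct_inv_one_add_smul_mul_transpose_comm a A z x
  let U : Matrix (Fin d) (Fin 2) ℝ := (Matrix.of ![x, z])ᵀ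
  let V : Matrix (Fin 2) (Fin d) ℝ :=
    Matrix.of ![(t ^ 2 * a * (w ⬝ᵥ w)) • x + (t * a) • z, (t * a) • x]
  have key : 1 + a • ((A + t • vecMulVec x w) * (A + t • vecMulVec x w)ᵀ) =
      (1 + a • (A * Aᵀ)) + U * V := by
    rw [add_assoc, add_right_inj]
    have hexp : (A + t • vecMulVec x w) * (A + t • vecMulVec x w)ᵀ =
        A * Aᵀ + t • vecMulVec z x + t • vecMulVec x z
          + (t ^ 2 * (w ⬝ᵥ w)) • vecMulVec x x := by
      have h₁ : vecMulVec x w * Aᵀ = vecMulVec x z := by rw [vecMulVec_mul, vecMul_transpose]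
      have h₂ : A * vecMulVec w x = vecMulVec z x := mul_vecMulVec _ _ _
      simp only [transpose_add, transpose_smul, transpose_vecMulVec, Matrix.add_mul,
        Matrix.mul_add, Matrix.smul_mul, Matrix.mul_smul, vecMulVec_mul_vecMulVec, h₁, h₂,
        vecMulVec_smul]
      module
    rw [hexp]
    ext i j
    simp [U, V, Matrix.mul_apply, Fin.sum_univ_two, vecMulVec_apply]
    ring
  rw [key, det_add_mul _ _ (isUnit_det_one_add_smul_mul_transpose ha A), det_fin_two]
  congr 1
  have hent : ∀ i j : Fin 2, (V * (1 + a • (A * Aᵀ))⁻¹ * U : Matrix (Fin 2) (Fin 2) ℝ) i j =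
      V i ⬝ᵥ (1 + a • (A * Aᵀ))⁻¹ *ᵥ (Uᵀ j) := by
    intro i j
    rw [Matrix.mul_assoc]
    rfl
  have hV₀ : V 0 = (t ^ 2 * a * (w ⬝ᵥ w)) • x + (t * a) • z := rfl
  have hV₁ : V 1 = (t * a) • x := rfl
  have hU₀ : Uᵀ 0 = x := rfl
  have hU₁ : Uᵀ 1 = z := rfl
  simp only [Matrix.add_apply, hent, hV₀, hV₁, hU₀, hU₁, add_dotProduct, smul_dotProduct,
    smul_eq_mul, hzx, one_apply_eq, one_apply_ne zero_ne_one, one_apply_ne one_ne_zero]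
  ring

/-- The second derivative of the coding rate along a rank-one direction. -/
lemma codingRate_hasSecondDerivAt_rankOne {a : ℝ} (ha : 0 ≤ a) (A : Matrix (Fin d) n ℝ)
    (x : Fin d → ℝ) (w : n → ℝ) :
    HasSecondDerivAt (fun t => codingRate a (A + t • vecMulVec x w))
      (a * (w ⬝ᵥ w) * (x ⬝ᵥ (1 + a • (A * Aᵀ))⁻¹ *ᵥ x)
        - a ^ 2 * (x ⬝ᵥ (1 + a • (A * Aᵀ))⁻¹ *ᵥ (A *ᵥ w)) ^ 2
        - a ^ 2 * (x ⬝ᵥ (1 + a • (A * Aᵀ))⁻¹ *ᵥ x)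
          * ((A *ᵥ w) ⬝ᵥ (1 + a • (A * Aᵀ))⁻¹ *ᵥ (A *ᵥ w))) 0 := by
  simp only [codingRate, det_one_add_smul_rankOne_line ha]
  convert (HasSecondDerivAt.log_quadratic
    (isUnit_det_one_add_smul_mul_transpose ha A).ne_zero _ _).const_mul (1 / 2) using 1
  ring

lemma frobSq_hasSecondDerivAt_rankOne (A : Matrix (Fin d) n ℝ) (x : Fin d → ℝ) (w : n → ℝ) :
    HasSecondDerivAt (fun t => frobSq (A + t • vecMulVec x w))
      (2 * ((x ⬝ᵥ x) * (w ⬝ᵥ w))) 0 := by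
  have h : ∀ t : ℝ, frobSq (A + t • vecMulVec x w) =
      frobSq A + (∑ i, ∑ j, 2 * A i j * (x i * w j)) * t + ((x ⬝ᵥ x) * (w ⬝ᵥ w)) * t ^ 2 := by
    intro t
    have h' : (x ⬝ᵥ x) * (w ⬝ᵥ w) = ∑ i, ∑ j, x i * x i * (w j * w j) :=
      Finset.sum_mul_sum _ _ _ _
    simp only [frobSq, h', Finset.sum_mul, ← Finset.sum_add_distrib]
    refine Finset.sum_congr rfl fun i _ => Finset.sum_congr rfl fun j _ => ?_
    simp [vecMulVec_apply]
    ring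
  simp only [h]
  exact HasSecondDerivAt.quadratic _ _ _

lemma inv_one_add_smul_mul_transpose_mulVec_of_eigen {a s : ℝ} (ha : 0 ≤ a) (hs : 1 + s ≠ 0)
    (A : Matrix (Fin d) n ℝ) {u : n → ℝ} (hu : a • (Aᵀ *ᵥ (A *ᵥ u)) = s • u) :
    (1 + a • (A * Aᵀ))⁻¹ *ᵥ (A *ᵥ u) = (1 + s)⁻¹ • (A *ᵥ u) := by
  have h : (1 + a • (A * Aᵀ)) *ᵥ (A *ᵥ u) = (1 + s) • (A *ᵥ u) := by
    rw [add_mulVec, one_mulVec, smul_mulVec, ← mulVec_mulVec, ← mulVec_smul, hu, mulVec_smul,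
      add_smul, one_smul]
  have h' := congrArg ((1 + a • (A * Aᵀ))⁻¹ *ᵥ ·) h
  simp only [mulVec_mulVec, mulVec_smul, Matrix.nonsing_inv_mul_cancel_left _ _
    (isUnit_det_one_add_smul_mul_transpose ha A)] at h'
  rw [eq_comm, inv_smul_eq_iff₀ hs, mulVec_mulVec]
  exact h'

lemma eigen_transpose_mulVec_of_inv_one_add_smul_mul_transpose {a s : ℝ} (ha : 0 ≤ a)
    (hs : 1 + s ≠ 0) (A : Matrix (Fin d) n ℝ) {y : Fin d → ℝ}
    (hy : Aᵀ *ᵥ ((1 + a • (A * Aᵀ))⁻¹ *ᵥ y) = (1 + s)⁻¹ • (Aᵀ *ᵥ y)) :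
    a • (Aᵀ *ᵥ (A *ᵥ (Aᵀ *ᵥ y))) = s • (Aᵀ *ᵥ y) := by
  obtain ⟨p, hp⟩ : ∃ p, p = (1 + a • (A * Aᵀ))⁻¹ *ᵥ y := ⟨_, rfl⟩
  have h : p + a • (A *ᵥ (Aᵀ *ᵥ p)) = y := by
    have : (1 + a • (A * Aᵀ)) *ᵥ p = y := by
      rw [hp, mulVec_mulVec, Matrix.mul_nonsing_inv _
        (isUnit_det_one_add_smul_mul_transpose ha A), one_mulVec]
    rw [← this, add_mulVec, one_mulVec, smul_mulVec, mulVec_mulVec]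
  have h' := congrArg (Aᵀ *ᵥ ·) h
  simp only [mulVec_add, mulVec_smul] at h'
  rw [← hp] at hy
  rw [hy, mulVec_smul, mulVec_smul, smul_comm a, ← smul_add, inv_smul_eq_iff₀ hs, add_smul,
    one_smul] at h'
  exact add_left_cancel h'

lemma exists_gram_eigenvector_mulVec_ne_zero {l : Type*} {A : Matrix (Fin d) n ℝ}
    {B : Matrix l (Fin d) ℝ} (h : B * A ≠ 0) :
    ∃ (v : n → ℝ) (σ : ℝ), 0 < σ ∧ Aᵀ *ᵥ (A *ᵥ v) = σ • v ∧ B *ᵥ (A *ᵥ v) ≠ 0 := by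
  classical
  have hA : (Aᵀ * A).IsHermitian := by
    simpa using Matrix.isHermitian_conjTranspose_mul_self A
  obtain ⟨j, hj⟩ : ∃ j, B *ᵥ (A *ᵥ (hA.eigenvectorBasis j).ofLp) ≠ 0 := by
    by_contra! hall
    refine h (Matrix.toLin'.injective ?_)
    have h0 : (Matrix.toLin' (B * A)) ∘ₗ (WithLp.linearEquiv 2 ℝ (n → ℝ)).toLinearMap = 0 :=
      hA.eigenvectorBasis.toBasis.ext fun j => by simpa using hall j
    refine LinearMap.ext fun v => ?_
    simpa using LinearMap.congr_fun h0 (WithLp.toLp 2 v)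
  set v := (hA.eigenvectorBasis j).ofLp
  have hv : Aᵀ *ᵥ (A *ᵥ v) = hA.eigenvalues j • v := by
    rw [mulVec_mulVec]
    exact hA.mulVec_eigenvectorBasis j
  refine ⟨v, hA.eigenvalues j, lt_of_le_of_ne ?_ ?_, hv, hj⟩
  · exact (by simpa using Matrix.posSemidef_conjTranspose_mul_self A :
      (Aᵀ * A).PosSemidef).eigenvalues_nonneg j
  · intro h0
    rw [← h0, zero_smul] at hv
    have hAv : A *ᵥ v = 0 := by
      rw [← dotProduct_self_eq_zero, dotProduct_mulVec, ← mulVec_transpose, hv, zero_dotProduct]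
    exact hj (by rw [hAv, mulVec_zero])

end CodingMatrix

section Blocks

variable {d K : ℕ} {mk : Fin K → ℕ} {ε lam : ℝ}
  {Z : Matrix (Fin d) ((k : Fin K) × Fin (mk k)) ℝ}

lemma mulVec_eq_sum_blk (Z : Matrix (Fin d) ((k : Fin K) × Fin (mk k)) ℝ)
    (w : ((k : Fin K) × Fin (mk k)) → ℝ) :
    Z *ᵥ w = ∑ k, blk mk Z k *ᵥ fun j => w ⟨k, j⟩ := by
  ext i
  simp [mulVec, dotProduct, Fintype.sum_sigma, blk]

lemma dotProduct_eq_sum_blk (w : ((k : Fin K) × Fin (mk k)) → ℝ) :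
    w ⬝ᵥ w = ∑ k, (fun j => w ⟨k, j⟩) ⬝ᵥ fun j => w ⟨k, j⟩ := by
  simp [dotProduct, Fintype.sum_sigma]

lemma mul_transpose_eq_sum_blk (Z : Matrix (Fin d) ((k : Fin K) × Fin (mk k)) ℝ) :
    Z * Zᵀ = ∑ k, blk mk Z k * (blk mk Z k)ᵀ := by
  ext i j
  simp [Matrix.mul_apply, Matrix.sum_apply, Fintype.sum_sigma, blk]

lemma alph_nonneg (d : ℕ) (mk : Fin K → ℕ) (ε : ℝ) : 0 ≤ alph d mk ε := by
  unfold alph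
  positivity

lemma alphK_nonneg (d : ℕ) (mk : Fin K → ℕ) (ε : ℝ) (k : Fin K) : 0 ≤ alphK d mk ε k := by
  unfold alphK
  positivity

lemma alphK_pos (hd : 0 < d) (hε : 0 < ε) {k : Fin K} (hk : 0 < mk k) :
    0 < alphK d mk ε k := by
  unfold alphK
  positivity

lemma alph_pos (hd : 0 < d) (hε : 0 < ε) {k : Fin K} (hk : 0 < mk k) : 0 < alph d mk ε := by
  have : 0 < mTot mk := hk.trans_le (Finset.single_le_sum (by simp) (Finset.mem_univ k))
  unfold alph
  positivity

lemma classWeight_mul_alphK {k : Fin K} (hk : 0 < mk k) :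
    (mk k : ℝ) / (mTot mk : ℝ) * alphK d mk ε k = alph d mk ε := by
  unfold alph alphK
  have : (mk k : ℝ) ≠ 0 := by positivity
  rw [div_mul_div_comm, mul_left_comm, mul_div_mul_left _ _ this]

/-- The Hessian of the objective along a rank-one direction that `Z` annihilates. -/
lemma hessAlong_mcr2F_vecMulVec (hmk : ∀ k, 0 < mk k) (x : Fin d → ℝ)
    {w : ((k : Fin K) × Fin (mk k)) → ℝ} (hw : Z *ᵥ w = 0) :
    hessAlong (mcr2F d K mk ε lam) Z (vecMulVec x w) =
      alph d mk ε * (w ⬝ᵥ w) * (x ⬝ᵥ (1 + alph d mk ε • (Z * Zᵀ))⁻¹ *ᵥ x)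
      - ∑ k, alph d mk ε *
          (((fun j => w ⟨k, j⟩) ⬝ᵥ fun j => w ⟨k, j⟩)
              * (x ⬝ᵥ (1 + alphK d mk ε k • (blk mk Z k * (blk mk Z k)ᵀ))⁻¹ *ᵥ x)
            - alphK d mk ε k
              * (x ⬝ᵥ (1 + alphK d mk ε k • (blk mk Z k * (blk mk Z k)ᵀ))⁻¹
                  *ᵥ (blk mk Z k *ᵥ fun j => w ⟨k, j⟩)) ^ 2
            - alphK d mk ε k
              * (x ⬝ᵥ (1 + alphK d mk ε k • (blk mk Z k * (blk mk Z k)ᵀ))⁻¹ *ᵥ x)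
              * ((blk mk Z k *ᵥ fun j => w ⟨k, j⟩)
                ⬝ᵥ (1 + alphK d mk ε k • (blk mk Z k * (blk mk Z k)ᵀ))⁻¹
                  *ᵥ (blk mk Z k *ᵥ fun j => w ⟨k, j⟩)))
      - lam * ((x ⬝ᵥ x) * (w ⬝ᵥ w)) := by
  have hR := codingRate_hasSecondDerivAt_rankOne (alph_nonneg d mk ε) Z x w
  have hRc := HasSecondDerivAt.sum fun k =>
    (codingRate_hasSecondDerivAt_rankOne (alphK_nonneg d mk ε k) (blk mk Z k) x
      fun j => w ⟨k, j⟩).const_mul ((mk k : ℝ) / (mTot mk : ℝ))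
  have hfrob := (frobSq_hasSecondDerivAt_rankOne Z x w).const_mul (lam / 2)
  refine ((hR.sub hRc).sub hfrob).iteratedDeriv_eq.trans ?_
  simp only [hw, mulVec_zero, dotProduct_zero]
  congr 1
  · congr 1
    · ring
    · refine Finset.sum_congr rfl fun k _ => ?_
      rw [← classWeight_mul_alphK (hmk k)]
      ring
  · ring

lemma IsCriticalPt.smul_mulVec_blk (h : IsCriticalPt d K mk ε lam Z) (k : Fin K)
    (u : Fin (mk k) → ℝ) :
    alph d mk ε • ((1 + alph d mk ε • (Z * Zᵀ))⁻¹ *ᵥ (blk mk Z k *ᵥ u)) =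
      alph d mk ε • ((1 + alphK d mk ε k • (blk mk Z k * (blk mk Z k)ᵀ))⁻¹ *ᵥ (blk mk Z k *ᵥ u))
        + lam • (blk mk Z k *ᵥ u) := by
  have h' := congrArg (· *ᵥ u) (h k)
  simp only [sub_mulVec, smul_mulVec, ← mulVec_mulVec, zero_mulVec] at h'
  rw [sub_sub, sub_eq_zero] at h'
  exact h'

lemma IsCriticalPt.smul_transpose_blk_mulVec (h : IsCriticalPt d K mk ε lam Z) (k : Fin K)
    (y : Fin d → ℝ) :
    alph d mk ε • ((blk mk Z k)ᵀ *ᵥ ((1 + alph d mk ε • (Z * Zᵀ))⁻¹ *ᵥ y)) =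
      alph d mk ε • ((blk mk Z k)ᵀ *ᵥ
          ((1 + alphK d mk ε k • (blk mk Z k * (blk mk Z k)ᵀ))⁻¹ *ᵥ y))
        + lam • ((blk mk Z k)ᵀ *ᵥ y) := by
  have h' := congrArg (fun A => Aᵀ *ᵥ y) (h k)
  simp only [transpose_sub, transpose_smul, transpose_mul, transpose_zero,
    inv_one_add_smul_mul_transpose_isSymm, sub_mulVec, smul_mulVec, ← mulVec_mulVec,
    zero_mulVec] at h'
  rw [sub_sub, sub_eq_zero] at h'
  exact h'

end Blocks

/-- **Proposition 4.5:** a critical point with two non-orthogonal blocks is a strict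
saddle point. -/
theorem mcr2_strictSaddle_of_not_orth (d K : ℕ) (mk : Fin K → ℕ) (ε lam : ℝ)
    (hmk : ∀ k, 0 < mk k) (hε : 0 < ε)
    (hlam0 : 0 < lam) (hlam : lam ≤ lamBound d mk ε)
    (Z : Matrix (Fin d) ((k : Fin K) × Fin (mk k)) ℝ)
    (hcrit : IsCriticalPt d K mk ε lam Z)
    (hnonorth : ∃ k l, k ≠ l ∧ (blk mk Z k)ᵀ * blk mk Z l ≠ 0) :
    ∃ D : Matrix (Fin d) ((k : Fin K) × Fin (mk k)) ℝ,
      0 < hessAlong (mcr2F d K mk ε lam) Z D := by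
  obtain ⟨k, l, hkl, hne⟩ := hnonorth
  obtain ⟨v, σ, hσ, hv, hlv⟩ := exists_gram_eigenvector_mulVec_ne_zero hne
  have hd : 0 < d := by
    rcases Nat.eq_zero_or_pos d with rfl | hd
    · exact absurd (by ext; simp [Matrix.mul_apply]) hne
    · exact hd
  have hα : 0 < alph d mk ε := alph_pos hd hε (hmk k)
  have hαK : ∀ j, 0 < alphK d mk ε j := fun j => alphK_pos hd hε (hmk j)
  obtain ⟨s, hs⟩ : ∃ s, s = alphK d mk ε l * σ := ⟨_, rfl⟩
  have hs_pos : 0 < s := hs ▸ mul_pos (hαK l) hσ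
  have h1s : 1 + s ≠ 0 := by positivity
  obtain ⟨μ, hμ⟩ : ∃ μ, μ = (1 + s)⁻¹ + lam / alph d mk ε := ⟨_, rfl⟩
  have hμ_pos : 0 < μ := hμ ▸ by positivity
  have hαμ : alph d mk ε * μ = alph d mk ε * (1 + s)⁻¹ + lam := by
    rw [hμ]
    field_simp
  set X := (1 + alph d mk ε • (Z * Zᵀ))⁻¹ with hX
  have hrange : ∀ j (u : Fin (mk j) → ℝ),
      alphK d mk ε j • ((blk mk Z j)ᵀ *ᵥ (blk mk Z j *ᵥ u)) = s • u →
      X *ᵥ (blk mk Z j *ᵥ u) = μ • (blk mk Z j *ᵥ u) := by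
    intro j u hu
    have h := hcrit.smul_mulVec_blk j u
    rw [inv_one_add_smul_mul_transpose_mulVec_of_eigen (hαK j).le h1s _ hu, smul_smul, ← add_smul,
      ← hαμ, mul_smul] at h
    exact smul_right_injective _ hα.ne' h
  have hcorange : ∀ j (y : Fin d → ℝ), X *ᵥ y = μ • y →
      alphK d mk ε j • ((blk mk Z j)ᵀ *ᵥ (blk mk Z j *ᵥ ((blk mk Z j)ᵀ *ᵥ y))) =
        s • ((blk mk Z j)ᵀ *ᵥ y) := by
    intro j y hy
    refine eigen_transpose_mulVec_of_inv_one_add_smul_mul_transpose (hαK j).le h1s _ ?_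
    have h := hcrit.smul_transpose_blk_mulVec j y
    rw [← hX, hy, mulVec_smul, smul_smul, hαμ, add_smul, add_left_inj, mul_smul] at h
    exact (smul_right_injective _ hα.ne' h).symm
  have hvs : alphK d mk ε l • ((blk mk Z l)ᵀ *ᵥ (blk mk Z l *ᵥ v)) = s • v := by
    rw [hv, smul_smul, hs]
  obtain ⟨a, ha⟩ : ∃ a, a = blk mk Z l *ᵥ v := ⟨_, rfl⟩
  have hXa : X *ᵥ a = μ • a := ha ▸ hrange l v hvs
  obtain ⟨c, hc⟩ : ∃ c : ℝ, (Z * Zᵀ) *ᵥ a = c • a := by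
    refine ⟨(alph d mk ε)⁻¹ * (μ⁻¹ - 1), ?_⟩
    have h := congrArg ((1 + alph d mk ε • (Z * Zᵀ)) *ᵥ ·) hXa
    simp only [mulVec_mulVec, hX, mulVec_smul, Matrix.mul_nonsing_inv _
      (isUnit_det_one_add_smul_mul_transpose hα.le Z), one_mulVec] at h
    rw [eq_comm, ← eq_inv_smul_iff₀ hμ_pos.ne', add_mulVec, one_mulVec, smul_mulVec,
      ← eq_sub_iff_add_eq'] at h
    rw [mul_smul, eq_inv_smul_iff₀ hα.ne', h, sub_smul, one_smul]
  let W : ∀ j, Fin (mk j) → ℝ := fun j =>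
    (blk mk Z j)ᵀ *ᵥ a - c • (Pi.single l v : ∀ j, Fin (mk j) → ℝ) j
  have hWk : W k = (blk mk Z k)ᵀ *ᵥ a := by simp [W, hkl]
  have hW : ∀ j, alphK d mk ε j • ((blk mk Z j)ᵀ *ᵥ (blk mk Z j *ᵥ W j)) = s • W j := by
    intro j
    rcases eq_or_ne j l with rfl | hj
    · simp only [W, Pi.single_eq_same, mulVec_sub, mulVec_smul, smul_sub, hcorange j a hXa,
        smul_comm (alphK d mk ε j) c, hvs, smul_comm s c]
    · simp only [W, Pi.single_eq_of_ne hj, smul_zero, sub_zero, hcorange j a hXa]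
  let w : ((j : Fin K) × Fin (mk j)) → ℝ := fun p => W p.1 p.2
  have hZw : Z *ᵥ w = 0 := by
    have hsingle : ∑ j, blk mk Z j *ᵥ (Pi.single l v : ∀ j, Fin (mk j) → ℝ) j = a := by
      rw [Finset.sum_eq_single l (fun j _ hj => by rw [Pi.single_eq_of_ne hj, mulVec_zero])
        (by simp), Pi.single_eq_same, ha]
    rw [mulVec_eq_sum_blk]
    change ∑ j, blk mk Z j *ᵥ W j = 0
    simp only [W, mulVec_sub, mulVec_smul, mulVec_mulVec, Finset.sum_sub_distrib,
      ← Finset.smul_sum, hsingle, ← Matrix.sum_mulVec, ← mul_transpose_eq_sum_blk, hc, sub_self]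
  have hnorm : ∀ j, alphK d mk ε j * ((blk mk Z j *ᵥ W j) ⬝ᵥ (blk mk Z j *ᵥ W j)) =
      s * (W j ⬝ᵥ W j) := fun j => by
    rw [dotProduct_mulVec, ← mulVec_transpose, ← smul_eq_mul, ← smul_dotProduct, hW,
      smul_dotProduct, smul_eq_mul]
  have hWk_pos : 0 < W k ⬝ᵥ W k := by
    have h := dotProduct_star_self_pos_iff.2 (hWk ▸ ha ▸ hlv : W k ≠ 0)
    rwa [star_trivial] at h
  obtain ⟨x, hx⟩ : ∃ x, x = blk mk Z k *ᵥ W k := ⟨_, rfl⟩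
  have hx_pos : 0 < x ⬝ᵥ x := by
    have h : alphK d mk ε k * (x ⬝ᵥ x) = s * (W k ⬝ᵥ W k) := hx ▸ hnorm k
    exact pos_of_mul_pos_right (h ▸ mul_pos hs_pos hWk_pos) (hαK k).le
  have hXx : X *ᵥ x = μ • x := hx ▸ hrange k _ (hW k)
  refine ⟨vecMulVec x w, ?_⟩
  have hres : ∀ j, (1 + alphK d mk ε j • (blk mk Z j * (blk mk Z j)ᵀ))⁻¹ *ᵥ (blk mk Z j *ᵥ W j) =
      (1 + s)⁻¹ • (blk mk Z j *ᵥ W j) := fun j =>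
    inv_one_add_smul_mul_transpose_mulVec_of_eigen (hαK j).le h1s _ (hW j)
  have hq_le : ∀ j, x ⬝ᵥ (1 + alphK d mk ε j • (blk mk Z j * (blk mk Z j)ᵀ))⁻¹ *ᵥ x ≤ x ⬝ᵥ x :=
    fun j => dotProduct_inv_one_add_smul_mul_transpose_le (hαK j).le _ x
  have hq_lt : x ⬝ᵥ (1 + alphK d mk ε k • (blk mk Z k * (blk mk Z k)ᵀ))⁻¹ *ᵥ x < x ⬝ᵥ x := by
    have h : (1 + alphK d mk ε k • (blk mk Z k * (blk mk Z k)ᵀ))⁻¹ *ᵥ x = (1 + s)⁻¹ • x :=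
      hx ▸ hres k
    rw [h, dotProduct_smul, smul_eq_mul]
    exact mul_lt_of_lt_one_left hx_pos (inv_lt_one_of_one_lt₀ (by linarith))
  have hterm : ∀ j, alph d mk ε *
      ((W j ⬝ᵥ W j) * (x ⬝ᵥ (1 + alphK d mk ε j • (blk mk Z j * (blk mk Z j)ᵀ))⁻¹ *ᵥ x)
        - alphK d mk ε j * (x ⬝ᵥ (1 + alphK d mk ε j • (blk mk Z j * (blk mk Z j)ᵀ))⁻¹
            *ᵥ (blk mk Z j *ᵥ W j)) ^ 2
        - alphK d mk ε j
          * (x ⬝ᵥ (1 + alphK d mk ε j • (blk mk Z j * (blk mk Z j)ᵀ))⁻¹ *ᵥ x)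
          * ((blk mk Z j *ᵥ W j) ⬝ᵥ (1 + alphK d mk ε j • (blk mk Z j * (blk mk Z j)ᵀ))⁻¹
              *ᵥ (blk mk Z j *ᵥ W j)))
      ≤ alph d mk ε * (1 + s)⁻¹ * (W j ⬝ᵥ W j)
        * (x ⬝ᵥ (1 + alphK d mk ε j • (blk mk Z j * (blk mk Z j)ᵀ))⁻¹ *ᵥ x) := by
    intro j
    rw [hres j, dotProduct_smul, dotProduct_smul, smul_eq_mul, smul_eq_mul, mul_assoc (alph d mk ε),
      mul_assoc (alph d mk ε)]
    refine mul_le_mul_of_nonneg_left ?_ hα.le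
    have hinv : (1 + s)⁻¹ * (1 + s) = 1 := inv_mul_cancel₀ h1s
    have hsq := mul_nonneg (hαK j).le
      (sq_nonneg ((1 + s)⁻¹ * (x ⬝ᵥ (blk mk Z j *ᵥ W j))))
    generalize x ⬝ᵥ (1 + alphK d mk ε j • (blk mk Z j * (blk mk Z j)ᵀ))⁻¹ *ᵥ x = q at *
    linear_combination hsq - (1 + s)⁻¹ * q * hnorm j - (W j ⬝ᵥ W j) * q * hinv
  have hW_nonneg : ∀ j, 0 ≤ W j ⬝ᵥ W j := fun j => by
    have h := dotProduct_star_self_nonneg (W j)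
    rwa [star_trivial] at h
  have hθ : 0 < alph d mk ε * (1 + s)⁻¹ := by positivity
  have hsum := Finset.sum_lt_sum
    (fun j (_ : j ∈ Finset.univ) => (hterm j).trans
      (mul_le_mul_of_nonneg_left (hq_le j) (mul_nonneg hθ.le (hW_nonneg j))))
    ⟨k, Finset.mem_univ k, (hterm k).trans_lt
      (mul_lt_mul_of_pos_left hq_lt (mul_pos hθ hWk_pos))⟩
  rw [← Finset.sum_mul, ← Finset.mul_sum _ _ (alph d mk ε * (1 + s)⁻¹)] at hsum
  have hww : w ⬝ᵥ w = ∑ j, W j ⬝ᵥ W j := dotProduct_eq_sum_blk w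
  rw [← hww] at hsum
  rw [hessAlong_mcr2F_vecMulVec hmk x hZw, ← hX, hXx, dotProduct_smul, smul_eq_mul]
  refine lt_of_lt_of_eq (sub_pos.2 hsum) ?_
  change _ - ∑ j, _ = _ - _ - _
  linear_combination (-(x ⬝ᵥ x) * (w ⬝ᵥ w)) * hαμ

end
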